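/- arXiv:1612.08269 — 4 statements merged into one kernel-verified Lean document; each statement's English description precedes it below -/
import Mathlib

section
/- Let K ≥ 2 be an integer and let Q(K) be the set of positive integers q such that p^(v_p(q)) ≤ K for every prime p. Let q ∈ Q(K) be divisible by 6. Then there exists an integer n ≥ 2 such that for every r ∈ Q(K): r divides n−1 if and only if r = 1; r divides n if and only if r divides q; and r divides n+1 if and only if r = 1. -/
/-- `QSet K` is the set of positive integers `q` such that `p ^ (v_p q) ≤ K`
for every prime `p`. -/
def QSet (K : ℕ) : Set ℕ :=
  {q | 0 < q ∧ ∀ p : ℕ, Nat.Prime p → p ^ (Nat.factorization q p) ≤ K}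

theorem le_of_prime_dvd_of_mem_QSet {K r p : ℕ} (hr : r ∈ QSet K) (hp : p.Prime) (hpr : p ∣ r) :
    p ≤ K :=
  (Nat.le_self_pow (hp.factorization_pos_of_dvd hr.1.ne' hpr).ne' p).trans (hr.2 p hp)

/-- There is `n ≡ q [MOD q * q]` with `n ≡ 2` modulo every prime `p ≤ K` not
dividing `q`. -/
theorem exists_modEq_self_and_modEq_two (K q : ℕ) :
    ∃ n : ℕ, n ≡ q [MOD q * q] ∧ ∀ p : ℕ, p.Prime → p ≤ K → ¬ p ∣ q → n ≡ 2 [MOD p] := by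
  let s := (Finset.range (K + 1)).filter fun p => p.Prime ∧ ¬ p ∣ q
  have hcop : Nat.Coprime (q * q) (∏ p ∈ s, p) := by
    refine Nat.Coprime.prod_right fun p hp => ?_
    have hp' := (Finset.mem_filter.mp hp).2
    have h : Nat.Coprime q p := ((Nat.Prime.coprime_iff_not_dvd hp'.1).mpr hp'.2).symm
    exact h.mul_left h
  obtain ⟨n, hn, hn2⟩ := Nat.chineseRemainder hcop q 2
  refine ⟨n, hn, fun p hp hpK hpq => hn2.of_dvd (Finset.dvd_prod_of_mem (fun p => p) ?_)⟩
  exact Finset.mem_filter.mpr ⟨Finset.mem_range.mpr (by omega), hp, hpq⟩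

theorem stmt_0 (K : ℕ) (hK : 2 ≤ K) (q : ℕ) (hq : q ∈ QSet K) (hq6 : 6 ∣ q) :
    ∃ n : ℕ, 2 ≤ n ∧ ∀ r ∈ QSet K,
      (r ∣ n - 1 ↔ r = 1) ∧ (r ∣ n ↔ r ∣ q) ∧ (r ∣ n + 1 ↔ r = 1) := by
  obtain ⟨n, hn, hn2⟩ := exists_modEq_self_and_modEq_two K q
  have hq0 : 0 < q := hq.1
  have h6 : 6 ≤ q := Nat.le_of_dvd hq0 hq6
  have hqn : q ≤ n := by
    have h : n % (q * q) = q := by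
      rw [hn, Nat.mod_eq_of_lt (by nlinarith)]
    exact h.symm.le.trans (Nat.mod_le _ _)
  obtain ⟨t, ht⟩ := (Nat.modEq_iff_dvd' hqn).mp hn.symm
  have hnt : n = q * (1 + q * t) := by
    have : n = q + q * q * t := by omega
    rw [this]; ring
  have two_dvd : 2 ∣ q := (by norm_num : 2 ∣ 6).trans hq6
  have three_dvd : 3 ∣ q := (by norm_num : 3 ∣ 6).trans hq6
  have dvd_n : ∀ p, p ∣ q → p ∣ n := fun p hp => hnt ▸ hp.mul_right _
  have not_dvd : ∀ p : ℕ, p.Prime → p ≤ K → ¬ p ∣ q → ¬ p ∣ n ∧ ¬ p ∣ n - 1 ∧ ¬ p ∣ n + 1 := by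
    intro p hp hpK hpq
    have h := hn2 p hp hpK hpq
    refine ⟨fun hd => ?_, fun hd => ?_, fun hd => ?_⟩
    · have h2 : p ∣ 2 := (h.dvd_iff dvd_rfl).mp hd
      exact hpq (h2.trans two_dvd)
    · have h1 : p ∣ n - 2 := (Nat.modEq_iff_dvd' (by omega)).mp h.symm
      have h1' := Nat.dvd_sub hd h1
      rw [show n - 1 - (n - 2) = 1 by omega] at h1'
      exact hp.one_lt.ne' (Nat.dvd_one.mp h1')
    · have h3 : p ∣ 2 + 1 := ((h.add_right 1).dvd_iff dvd_rfl).mp hd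
      exact hpq (h3.trans three_dvd)
  refine ⟨n, by omega, fun r hr => ⟨⟨fun hd => ?_, fun h => h.symm ▸ one_dvd _⟩,
    ⟨fun hd => ?_, dvd_n r⟩, ⟨fun hd => ?_, fun h => h.symm ▸ one_dvd _⟩⟩⟩
  · by_contra hr1
    obtain ⟨p, hp, hpr⟩ := Nat.exists_prime_and_dvd hr1
    by_cases hpq : p ∣ q
    · have h := Nat.dvd_sub (dvd_n p hpq) (hpr.trans hd)
      rw [show n - (n - 1) = 1 by omega] at h
      exact hp.one_lt.ne' (Nat.dvd_one.mp h)
    · exact (not_dvd p hp (le_of_prime_dvd_of_mem_QSet hr hp hpr) hpq).2.1 (hpr.trans hd)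
  · have hcop : Nat.Coprime r (1 + q * t) := by
      refine Nat.coprime_of_dvd fun p hp hpr hpt => ?_
      by_cases hpq : p ∣ q
      · exact hp.one_lt.ne' (Nat.dvd_one.mp ((Nat.dvd_add_left (hpq.mul_right t)).mp hpt))
      · exact (not_dvd p hp (le_of_prime_dvd_of_mem_QSet hr hp hpr) hpq).1
          (hnt ▸ hpt.mul_left q)
    exact hcop.dvd_of_dvd_mul_right (hnt ▸ hd)
  · by_contra hr1
    obtain ⟨p, hp, hpr⟩ := Nat.exists_prime_and_dvd hr1
    by_cases hpq : p ∣ q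
    · exact hp.one_lt.ne' (Nat.dvd_one.mp ((Nat.dvd_add_right (dvd_n p hpq)).mp (hpr.trans hd)))
    · exact (not_dvd p hp (le_of_prime_dvd_of_mem_QSet hr hp hpr) hpq).2.2 (hpr.trans hd)
end

section
/- Let K ≥ 2 be an integer and let Q(K) be the set of positive integers q such that p^(v_p(q)) ≤ K for every prime p. Then there exists an integer n ≥ 5 such that for every r ∈ Q(K): r divides n−4 if and only if r divides 4; r divides n−3 if and only if r divides 3; r divides n−2 if and only if r divides 2; r divides n−1 if and only if r = 1; 6 divides n; r divides n+1 if and only if r = 1; r divides n+2 if and only if r divides 2; r divides n+3 if and only if r divides 3; and r divides n+4 if and only if r divides 4. -/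
theorem dvd_factorial_of_mem_QSet {K r : ℕ} (hr : r ∈ QSet K) : r ∣ K.factorial := by
  obtain ⟨hpos, hle⟩ := hr
  rw [Nat.dvd_iff_prime_pow_dvd_dvd]
  intro p k hp hk
  have hkle : k ≤ r.factorization p := (hp.pow_dvd_iff_le_factorization hpos.ne').1 hk
  exact Nat.dvd_factorial (pow_pos hp.pos k) ((Nat.pow_le_pow_right hp.pos hkle).trans (hle p hp))

theorem stmt_4 (K : ℕ) (hK : 2 ≤ K) :
    ∃ n : ℕ, 5 ≤ n ∧ 6 ∣ n ∧ ∀ r ∈ QSet K,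
      (r ∣ n - 4 ↔ r ∣ 4) ∧ (r ∣ n - 3 ↔ r ∣ 3) ∧ (r ∣ n - 2 ↔ r ∣ 2) ∧
        (r ∣ n - 1 ↔ r = 1) ∧ (r ∣ n + 1 ↔ r = 1) ∧ (r ∣ n + 2 ↔ r ∣ 2) ∧
        (r ∣ n + 3 ↔ r ∣ 3) ∧ (r ∣ n + 4 ↔ r ∣ 4) := by
  have hn : 5 ≤ 6 * K.factorial := by have := K.factorial_pos; omega
  refine ⟨6 * K.factorial, hn, dvd_mul_right _ _, fun r hr => ?_⟩
  have hdvd : r ∣ 6 * K.factorial := (dvd_factorial_of_mem_QSet hr).mul_left 6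
  have hadd (j : ℕ) : r ∣ 6 * K.factorial + j ↔ r ∣ j := Nat.dvd_add_right hdvd
  have hsub (j : ℕ) (hj : j ≤ 6 * K.factorial) : r ∣ 6 * K.factorial - j ↔ r ∣ j :=
    Nat.dvd_sub_iff_right hj hdvd
  rw [← Nat.dvd_one (n := r)]
  exact ⟨hsub 4 (by omega), hsub 3 (by omega), hsub 2 (by omega), hsub 1 (by omega),
    hadd 1, hadd 2, hadd 3, hadd 4⟩
end

section
/- Let K ≥ 2 be an integer and let Q(K) be the set of positive integers q such that p^(v_p(q)) ≤ K for every prime p. Let q ∈ Q(K) be such that 2 divides q, 4 does not divide q, and 3 does not divide q. Then there exists an integer n ≥ 4 such that for every r ∈ Q(K): r divides n−3 if and only if r = 1; r divides n−2 if and only if r divides 4; r divides n−1 if and only if r divides 3; r divides n if and only if r divides q; if 5 divides q then (r divides n+1 if and only if r = 1) and if 5 does not divide q then (r divides n+1 if and only if r divides 5); 6 divides n+2; and r divides n+3 if and only if r = 1. -/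
theorem prime_le_of_dvd_of_mem_QSet {K r p : ℕ} (hr : r ∈ QSet K) (hp : p.Prime)
    (h : p ∣ r) : p ≤ K :=
  (Nat.le_self_pow (hp.factorization_pos_of_dvd hr.1.ne' h).ne' p).trans (hr.2 p hp)

theorem dvd_iff_dvd_of_mem_QSet {K r a b : ℕ} (hr : r ∈ QSet K)
    (h : ∀ p, p.Prime → p ≤ K → ∀ k, p ^ k ∣ a ↔ p ^ k ∣ b) : r ∣ a ↔ r ∣ b := by
  rw [Nat.dvd_iff_prime_pow_dvd_dvd, Nat.dvd_iff_prime_pow_dvd_dvd]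
  refine forall_congr' fun p => forall_congr' fun k => forall_congr' fun hp =>
    forall_congr' fun hk => ?_
  rcases Nat.eq_zero_or_pos k with rfl | hk0
  · simp
  · exact h p hp (prime_le_of_dvd_of_mem_QSet hr hp
      ((dvd_pow_self p hk0.ne').trans hk)) k

theorem pow_dvd_iff_of_modEq {p e a b : ℕ} (h : a ≡ b [MOD p ^ e]) (hb : ¬ p ^ e ∣ b)
    (k : ℕ) : p ^ k ∣ a ↔ p ^ k ∣ b := by
  rcases le_total k e with hke | hke
  · exact h.dvd_iff (pow_dvd_pow p hke)
  · have ha : ¬ p ^ e ∣ a := fun H => hb ((h.dvd_iff dvd_rfl).1 H)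
    exact iff_of_false (fun H => ha ((pow_dvd_pow p hke).trans H))
      (fun H => hb ((pow_dvd_pow p hke).trans H))

theorem pow_dvd_iff_of_not_dvd {p a b : ℕ} (ha : ¬ p ∣ a) (hb : ¬ p ∣ b) (k : ℕ) :
    p ^ k ∣ a ↔ p ^ k ∣ b := by
  rcases Nat.eq_zero_or_pos k with rfl | hk
  · simp
  · exact iff_of_false (fun H => ha ((dvd_pow_self p hk.ne').trans H))
      (fun H => hb ((dvd_pow_self p hk.ne').trans H))

theorem exists_modEq_prime_pow (B e : ℕ) (a : ℕ → ℕ) :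
    ∃ n : ℕ, ∀ p, p.Prime → p ≤ B → n ≡ a p [MOD p ^ e] := by
  classical
  obtain ⟨n, hn⟩ := Nat.chineseRemainderOfFinset a (fun p => p ^ e)
    ((Finset.range (B + 1)).filter Nat.Prime)
    (fun p hp => pow_ne_zero e (Finset.mem_filter.1 hp).2.ne_zero)
    (fun p hp p' hp' hne => Nat.Coprime.pow _ _
      ((Nat.coprime_primes (Finset.mem_filter.1 hp).2 (Finset.mem_filter.1 hp').2).2 hne))
  exact ⟨n, fun p hp hpB => hn p (Finset.mem_filter.2 ⟨Finset.mem_range.2 (by omega), hp⟩)⟩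

theorem exists_prescribed_residues (K q : ℕ) :
    ∃ n : ℕ, n % 8 = 6 ∧ n % 9 = 4 ∧ (¬ 5 ∣ q → n % 25 = 4) ∧
      (∀ p, p.Prime → p ≤ K + 5 → 5 ≤ p → p ∣ q → n ≡ q [MOD p ^ (q + 3)]) ∧
      (∀ p, p.Prime → p ≤ K → 7 ≤ p → ¬ p ∣ q → p ∣ n + 2) := by
  obtain ⟨n, hn⟩ := exists_modEq_prime_pow (K + 5) (q + 3) fun p =>
    if p = 2 then 6 else if p = 3 then 4 else if p ∣ q then q else
      if p = 5 then 4 else p - 2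
  refine ⟨n, ?_, ?_, fun h5 => ?_, fun p hp hpK h5 hpq => ?_, fun p hp hpK h7 hpq => ?_⟩
  · have h := hn 2 Nat.prime_two (by omega)
    simp only [if_true] at h
    exact h.of_dvd (pow_dvd_pow 2 (by omega : 3 ≤ q + 3))
  · have h := hn 3 Nat.prime_three (by omega)
    norm_num at h
    exact h.of_dvd (pow_dvd_pow 3 (by omega : 2 ≤ q + 3))
  · have h := hn 5 Nat.prime_five (by omega)
    norm_num [h5] at h
    exact h.of_dvd (pow_dvd_pow 5 (by omega : 2 ≤ q + 3))
  · have h := hn p hp hpK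
    rwa [if_neg (by omega), if_neg (by omega), if_pos hpq] at h
  · have h := hn p hp (by omega)
    rw [if_neg (by omega), if_neg (by omega), if_neg hpq, if_neg (by omega)] at h
    have h' := (h.of_dvd (dvd_pow_self p (by omega))).add_right 2
    rw [Nat.sub_add_cancel (by omega)] at h'
    exact (h'.dvd_iff dvd_rfl).2 dvd_rfl

/-- Let `p ≥ 5` and suppose that `p ∣ n`, or that `p ≥ 7` and `p ∣ n + 2`, or that `p = 5` and
`n ≡ 4` modulo `25`. Then `p` divides none of `n - 3`, `n - 2`, `n - 1`, `n + 3`, and it divides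
`n + 1` only in the last case. -/
theorem not_dvd_neighbours {n p : ℕ} (hn : 4 ≤ n) (hp5 : 5 ≤ p)
    (h : p ∣ n ∨ (7 ≤ p ∧ p ∣ n + 2) ∨ (p = 5 ∧ n % 25 = 4)) :
    ¬ p ∣ n - 3 ∧ ¬ p ∣ n - 2 ∧ ¬ p ∣ n - 1 ∧ ¬ p ∣ n + 3 ∧ (p ∣ n + 1 → p = 5 ∧ n % 25 = 4) := by
  obtain ⟨m, rfl⟩ : ∃ m, n = m + 3 := ⟨n - 3, by omega⟩
  have key : ∀ {x y : ℕ}, p ∣ x → p ∣ y → x < y → p ≤ y - x := fun hx hy hxy =>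
    Nat.le_of_dvd (by omega) (Nat.dvd_sub hy hx)
  rcases h with h | ⟨h7, h⟩ | ⟨rfl, h⟩
  · refine ⟨fun H => ?_, fun H => ?_, fun H => ?_, fun H => ?_, fun H => ?_⟩
    · have := key H h (by omega); omega
    · have := key H h (by omega); omega
    · have := key H h (by omega); omega
    · have := key h H (by omega); omega
    · have := key h H (by omega); omega
  · refine ⟨fun H => ?_, fun H => ?_, fun H => ?_, fun H => ?_, fun H => ?_⟩
    · have := key H h (by omega); omega
    · have := key H h (by omega); omega
    · have := key H h (by omega); omega
    · have := key h H (by omega); omega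
    · have := key H h (by omega); omega
  · omega

theorem stmt_5 (K : ℕ) (hK : 2 ≤ K) (q : ℕ) (hq : q ∈ QSet K)
    (hq2 : 2 ∣ q) (hq4 : ¬ 4 ∣ q) (hq3 : ¬ 3 ∣ q) :
    ∃ n : ℕ, 4 ≤ n ∧ 6 ∣ n + 2 ∧ ∀ r ∈ QSet K,
      (r ∣ n - 3 ↔ r = 1) ∧ (r ∣ n - 2 ↔ r ∣ 4) ∧ (r ∣ n - 1 ↔ r ∣ 3) ∧
        (r ∣ n ↔ r ∣ q) ∧
        (5 ∣ q → (r ∣ n + 1 ↔ r = 1)) ∧ (¬ 5 ∣ q → (r ∣ n + 1 ↔ r ∣ 5)) ∧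
        (r ∣ n + 3 ↔ r = 1) := by
  obtain ⟨n, h8, h9, h25, hdvd, hndvd⟩ := exists_prescribed_residues K q
  have hn : 4 ≤ n := by omega
  have hpn : ∀ p, p.Prime → p ≤ K + 5 → 5 ≤ p → p ∣ q → p ∣ n := fun p hp hpK h5 hpq =>
    ((hdvd p hp hpK h5 hpq).dvd_iff (dvd_pow_self p (by omega))).2 hpq
  have hn5 : 5 ∣ q → n % 5 = 0 := fun h =>
    Nat.mod_eq_zero_of_dvd (hpn 5 Nat.prime_five (by omega) le_rfl h)
  have cases_prime : ∀ p, p.Prime → p = 2 ∨ p = 3 ∨ 5 ≤ p := by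
    intro p hp
    by_contra! H
    have h2 := hp.two_le
    have : p = 4 := by omega
    subst this
    exact absurd hp (by decide)
  have hnb : ∀ p, p.Prime → p ≤ K → 5 ≤ p → ¬ p ∣ n - 3 ∧ ¬ p ∣ n - 2 ∧ ¬ p ∣ n - 1 ∧
      ¬ p ∣ n + 3 ∧ (p ∣ n + 1 → p = 5 ∧ n % 25 = 4) := by
    intro p hp hpK h5
    refine not_dvd_neighbours hn h5 ?_
    by_cases hpq : p ∣ q
    · exact .inl (hpn p hp (by omega) h5 hpq)
    · rcases (by omega : p = 5 ∨ p = 6 ∨ 7 ≤ p) with rfl | rfl | h7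
      · exact .inr (.inr ⟨rfl, h25 hpq⟩)
      · exact absurd hp (by decide)
      · exact .inr (.inl ⟨h7, hndvd p hp hpK h7 hpq⟩)
  have not_dvd_small : ∀ {p m : ℕ}, 0 < m → m < p → ¬ p ∣ m := fun h0 h =>
    Nat.not_dvd_of_pos_of_lt h0 h
  refine ⟨n, hn, by omega, fun r hr => ⟨?_, ?_, ?_, ?_, fun h5q => ?_, fun h5q => ?_, ?_⟩⟩
  · rw [← Nat.dvd_one]
    refine dvd_iff_dvd_of_mem_QSet hr fun p hp hpK =>
      pow_dvd_iff_of_not_dvd ?_ hp.not_dvd_one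
    rcases cases_prime p hp with rfl | rfl | h5
    · omega
    · omega
    · exact (hnb p hp hpK h5).1
  · refine dvd_iff_dvd_of_mem_QSet hr fun p hp hpK => ?_
    rcases cases_prime p hp with rfl | rfl | h5
    · refine pow_dvd_iff_of_modEq (e := 3) ?_ (by norm_num)
      show (n - 2) % 8 = 4 % 8
      omega
    · exact pow_dvd_iff_of_not_dvd (by omega) (by omega)
    · exact pow_dvd_iff_of_not_dvd (hnb p hp hpK h5).2.1
        (not_dvd_small (by omega) (by omega))
  · refine dvd_iff_dvd_of_mem_QSet hr fun p hp hpK => ?_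
    rcases cases_prime p hp with rfl | rfl | h5
    · exact pow_dvd_iff_of_not_dvd (by omega) (by omega)
    · refine pow_dvd_iff_of_modEq (e := 2) ?_ (by norm_num)
      show (n - 1) % 9 = 3 % 9
      omega
    · exact pow_dvd_iff_of_not_dvd (hnb p hp hpK h5).2.2.1
        (not_dvd_small (by omega) (by omega))
  · refine dvd_iff_dvd_of_mem_QSet hr fun p hp hpK => ?_
    rcases cases_prime p hp with rfl | rfl | h5
    · refine pow_dvd_iff_of_modEq (e := 2) ?_ (by omega)
      show n % 4 = q % 4
      omega
    · exact pow_dvd_iff_of_not_dvd (by omega) hq3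
    · by_cases hpq : p ∣ q
      · refine pow_dvd_iff_of_modEq (hdvd p hp (by omega) h5 hpq)
          (not_dvd_small hq.1 ?_)
        exact (by omega : q < q + 3).trans (Nat.lt_pow_self hp.one_lt)
      · refine pow_dvd_iff_of_not_dvd (fun H => ?_) hpq
        rcases (by omega : p = 5 ∨ p = 6 ∨ 7 ≤ p) with rfl | rfl | h7
        · have := h25 hpq
          omega
        · exact absurd hp (by decide)
        · exact not_dvd_small two_pos (by omega)
            ((Nat.dvd_add_right H).1 (hndvd p hp hpK h7 hpq))
  · rw [← Nat.dvd_one]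
    refine dvd_iff_dvd_of_mem_QSet hr fun p hp hpK =>
      pow_dvd_iff_of_not_dvd ?_ hp.not_dvd_one
    rcases cases_prime p hp with rfl | rfl | h5
    · omega
    · omega
    · intro H
      have := (hnb p hp hpK h5).2.2.2.2 H
      have := hn5 h5q
      omega
  · have h4 := h25 h5q
    refine dvd_iff_dvd_of_mem_QSet hr fun p hp hpK => ?_
    rcases cases_prime p hp with rfl | rfl | h5
    · exact pow_dvd_iff_of_not_dvd (by omega) (by omega)
    · exact pow_dvd_iff_of_not_dvd (by omega) (by omega)
    · rcases h5.eq_or_lt with rfl | h5'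
      · refine pow_dvd_iff_of_modEq (e := 2) ?_ (by norm_num)
        show (n + 1) % 25 = 5 % 25
        omega
      · refine pow_dvd_iff_of_not_dvd (fun H => ?_) (not_dvd_small (by omega) h5')
        have := (hnb p hp hpK h5).2.2.2.2 H
        omega
  · rw [← Nat.dvd_one]
    refine dvd_iff_dvd_of_mem_QSet hr fun p hp hpK =>
      pow_dvd_iff_of_not_dvd ?_ hp.not_dvd_one
    rcases cases_prime p hp with rfl | rfl | h5
    · omega
    · omega
    · exact (hnb p hp hpK h5).2.2.2.1
end

section
/- Let d ≥ 1, let δ_1, …, δ_d be positive integers, let m be a natural number, and let x be a real number with |x| < 1. Then the family k ↦ x^{k_1 + ⋯ + k_d}, indexed by the set of k ∈ ℕ^d with k_i ≥ 1 for all i and min_{1 ≤ i ≤ d} k_i δ_i ≤ m, is summable, and its sum equals (1 − x^{∑_{i=1}^d ⌊m/δ_i⌋}) · (x/(1−x))^d. -/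
/-- A finite product of absolutely convergent series, expanded as a single absolutely convergent
series over tuples of indices. -/
theorem hasSum_fin_pi_prod {R ι : Type*} [NormedCommRing R] [CompleteSpace R] {d : ℕ}
    {f : Fin d → ι → R} {a : Fin d → R} (hf : ∀ i, HasSum (f i) (a i))
    (hn : ∀ i, Summable fun n => ‖f i n‖) :
    HasSum (fun k : Fin d → ι => ∏ i, f i (k i)) (∏ i, a i) ∧
      Summable fun k : Fin d → ι => ‖∏ i, f i (k i)‖ := by
  induction d with
  | zero => exact ⟨by simp [hasSum_unique], (hasSum_fintype _).summable⟩
  | succ d ih =>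
    obtain ⟨h, h'⟩ := ih (fun i => hf i.succ) (fun i => hn i.succ)
    have hs : Summable fun p : ι × (Fin d → ι) => f 0 p.1 * ∏ i : Fin d, f i.succ (p.2 i) :=
      summable_mul_of_summable_norm (f := f 0)
        (g := fun k : Fin d → ι => ∏ i : Fin d, f i.succ (k i)) (hn 0) h'
    constructor
    · rw [← (Fin.consEquiv fun _ : Fin (d + 1) => ι).hasSum_iff, Fin.prod_univ_succ]
      simpa [Function.comp_def, Fin.prod_univ_succ, Fin.consEquiv] using
        (hf 0).mul h hs
    · rw [← (Fin.consEquiv fun _ : Fin (d + 1) => ι).summable_iff]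
      simpa [Function.comp_def, Fin.prod_univ_succ, Fin.consEquiv] using (hn 0).mul_norm h'

theorem hasSum_ite_lt_geometric {x : ℝ} (hx : |x| < 1) (c : ℕ) :
    HasSum (fun n : ℕ => if c < n then x ^ n else 0) (x ^ c * (x / (1 - x))) := by
  have hfun : ∀ n, (if c < n + (c + 1) then x ^ (n + (c + 1)) else 0) = x ^ (c + 1) * x ^ n :=
    fun n => by rw [if_pos (by omega), pow_add, mul_comm]
  have hzero : ∑ n ∈ Finset.range (c + 1), (if c < n then x ^ n else 0) = 0 :=
    Finset.sum_eq_zero fun n hn => if_neg (by have := Finset.mem_range.mp hn; omega)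
  rw [← hasSum_nat_add_iff' (c + 1), hzero, sub_zero, funext hfun,
    show x ^ c * (x / (1 - x)) = x ^ (c + 1) * (1 - x)⁻¹ by ring]
  exact (hasSum_geometric_of_abs_lt_one hx).mul_left _

theorem hasSum_ite_forall_lt_pow_sum {d : ℕ} {x : ℝ} (hx : |x| < 1) (c : Fin d → ℕ) :
    HasSum (fun k : Fin d → ℕ => if ∀ i, c i < k i then x ^ ∑ i, k i else 0)
      (x ^ (∑ i, c i) * (x / (1 - x)) ^ d) := by
  have h := (hasSum_fin_pi_prod (fun i => hasSum_ite_lt_geometric hx (c i))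
    fun i => (hasSum_ite_lt_geometric hx (c i)).summable.norm).1
  simpa only [Finset.prod_ite_zero, Finset.prod_pow_eq_pow_sum, Finset.prod_mul_distrib,
    Finset.mem_univ, true_imp_iff, Finset.prod_const, Finset.card_univ, Fintype.card_fin] using h

open Classical in
theorem hasSum_subtype_iff_ite {α β : Type*} [AddCommMonoid α] [TopologicalSpace α]
    {p : β → Prop} {f : β → α} {a : α} :
    HasSum (fun b : {b // p b} => f b) a ↔ HasSum (fun b => if p b then f b else 0) a := by
  rw [← Function.Injective.hasSum_iff (g := (Subtype.val : {b // p b} → β)) Subtype.val_injective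
    fun b hb => if_neg fun h => hb ⟨⟨b, h⟩, rfl⟩]
  exact iff_of_eq (congrArg (HasSum · a) (funext fun b => (if_pos b.2).symm))

theorem stmt_16 (d : ℕ) (hd : 0 < d) (δ : Fin d → ℕ) (hδ : ∀ i, 0 < δ i) (m : ℕ)
    (x : ℝ) (hx : |x| < 1) :
    HasSum
      (fun p : {k : Fin d → ℕ // (∀ i, 1 ≤ k i) ∧
          (Finset.univ.inf' (Finset.univ_nonempty_iff.mpr (Fin.pos_iff_nonempty.mp hd))
            fun i => k i * δ i) ≤ m} => x ^ (∑ i, p.1 i))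
      ((1 - x ^ (∑ i, m / δ i)) * (x / (1 - x)) ^ d) := by
  have h := (hasSum_ite_forall_lt_pow_sum hx fun _ : Fin d => 0).sub
    (hasSum_ite_forall_lt_pow_sum hx fun i => m / δ i)
  rw [Finset.sum_const_zero, pow_zero, ← sub_mul] at h
  rw [hasSum_subtype_iff_ite (f := fun k : Fin d → ℕ => x ^ ∑ i, k i)]
  refine h.congr_fun fun k => ?_
  have hlt : ∀ i, m / δ i < k i ↔ m < k i * δ i := fun i => Nat.div_lt_iff_lt_mul (hδ i)
  have hpos : (∀ i, m < k i * δ i) → ∀ i, 0 < k i := fun h i =>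
    Nat.pos_of_mul_pos_right ((Nat.zero_le m).trans_lt (h i))
  simp only [hlt, Finset.inf'_le_iff, Finset.mem_univ, true_and, Nat.one_le_iff_ne_zero,
    ← Nat.pos_iff_ne_zero]
  by_cases hk : ∀ i, m < k i * δ i
  · have hk' : ¬ ∃ i, k i * δ i ≤ m := by simpa using hk
    rw [if_neg fun h => hk' h.2, if_pos (hpos hk), if_pos hk, sub_self]
  · have hk' : ∃ i, k i * δ i ≤ m := by simpa using hk
    simp only [hk, hk', and_true, if_false, sub_zero]
end
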